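/- arXiv:1806.04438 — 4 statements merged into one kernel-verified Lean document; each statement's English description precedes it below -/
import Mathlib

section
/- Assume μ₊ > 0, μ₋ > 0 and ν_a < 0 are such that for all x ∈ [0,L] and all v ∈ ℝ² one has vᵀ [ E'(x) D(x) + E(x) D'(x) − |η₀| ( E(x) M(x) + M(x)ᵀ E(x) ) ] v ≤ ν_a vᵀ E(x) v. Let r : [0,T] × [0,L] → ℝ² be continuously differentiable, solve the forward system r_t + D(x) r_x = η₀ M(x) r, and satisfy the homogeneous boundary conditions r₊(t,0) = 0 and r₋(t,L) = 0 for all t ∈ [0,T]. Define E₁(t) = (1/2) ∫_0^L r(t,x)ᵀ E(x) r(t,x) dx. Then for all t ∈ [0,T]: E₁(t) ≤ E₁(0) exp(ν_a t). -/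
open Set Real Matrix

/-- A function continuous on a product of two compact intervals is bounded there. -/
lemma exists_norm_le_of_continuousOn_Icc_prod {F : ℝ → ℝ → ℝ} {a b c d : ℝ}
    (hF : ContinuousOn (fun p : ℝ × ℝ => F p.1 p.2) (Icc a b ×ˢ Icc c d)) :
    ∃ C, ∀ t ∈ Icc a b, ∀ x ∈ Icc c d, ‖F t x‖ ≤ C := by
  obtain ⟨C, hC⟩ := (isCompact_Icc.prod isCompact_Icc).exists_bound_of_continuousOn hF
  exact ⟨C, fun t ht x hx => hC (t, x) ⟨ht, hx⟩⟩

lemma continuousOn_right_of_continuousOn_Icc_prod {F : ℝ → ℝ → ℝ} {a b c d : ℝ}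
    (hF : ContinuousOn (fun p : ℝ × ℝ => F p.1 p.2) (Icc a b ×ˢ Icc c d)) {t : ℝ}
    (ht : t ∈ Icc a b) : ContinuousOn (F t) (Icc c d) :=
  hF.comp (f := fun x => (t, x)) (by fun_prop) fun _ hx => ⟨ht, hx⟩

lemma aestronglyMeasurable_uIoc_of_continuousOn {f : ℝ → ℝ} {c d : ℝ} (hcd : c ≤ d)
    (hf : ContinuousOn f (Icc c d)) :
    MeasureTheory.AEStronglyMeasurable f (MeasureTheory.volume.restrict (uIoc c d)) := by
  rw [uIoc_of_le hcd]
  exact (hf.mono Ioc_subset_Icc_self).aestronglyMeasurable measurableSet_Ioc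

/-- Continuity of an integral depending on a parameter in a compact interval. -/
lemma continuousOn_parametric_integral_Icc {F : ℝ → ℝ → ℝ} {a b c d : ℝ} (hcd : c ≤ d)
    (hF : ContinuousOn (fun p : ℝ × ℝ => F p.1 p.2) (Icc a b ×ˢ Icc c d)) :
    ContinuousOn (fun t => ∫ x in c..d, F t x) (Icc a b) := by
  obtain ⟨C, hC⟩ := exists_norm_le_of_continuousOn_Icc_prod hF
  intro t ht
  refine intervalIntegral.continuousWithinAt_of_dominated_interval (bound := fun _ => C)
    ?_ ?_ (by simp) ?_
  · filter_upwards [self_mem_nhdsWithin] with s hs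
    exact aestronglyMeasurable_uIoc_of_continuousOn hcd
      (continuousOn_right_of_continuousOn_Icc_prod hF hs)
  · filter_upwards [self_mem_nhdsWithin] with s hs
    refine Filter.Eventually.of_forall fun x hx => hC s hs x ?_
    rw [uIoc_of_le hcd] at hx
    exact Ioc_subset_Icc_self hx
  · refine Filter.Eventually.of_forall fun x hx => ?_
    rw [uIoc_of_le hcd] at hx
    exact (hF.comp (f := fun s => (s, x)) (by fun_prop)
      fun _ hs => ⟨hs, Ioc_subset_Icc_self hx⟩) t ht

/-- Differentiation under the integral sign at interior points of a compact interval. -/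
lemma hasDerivAt_parametric_integral_Ioo {F F' : ℝ → ℝ → ℝ} {a b c d : ℝ} (hcd : c ≤ d)
    (hF : ContinuousOn (fun p : ℝ × ℝ => F p.1 p.2) (Icc a b ×ˢ Icc c d))
    (hF' : ContinuousOn (fun p : ℝ × ℝ => F' p.1 p.2) (Icc a b ×ˢ Icc c d))
    (hd : ∀ t ∈ Icc a b, ∀ x ∈ Icc c d, HasDerivAt (fun s => F s x) (F' t x) t)
    {t : ℝ} (ht : t ∈ Ioo a b) :
    HasDerivAt (fun s => ∫ x in c..d, F s x) (∫ x in c..d, F' t x) t := by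
  obtain ⟨C, hC⟩ := exists_norm_le_of_continuousOn_Icc_prod hF'
  have hsub : uIoc c d ⊆ Icc c d := uIoc_of_le hcd ▸ Ioc_subset_Icc_self
  have htI := Ioo_subset_Icc_self ht
  refine (intervalIntegral.hasDerivAt_integral_of_dominated_loc_of_deriv_le
    (bound := fun _ => C) (isOpen_Ioo.mem_nhds ht) ?_ ?_ ?_ ?_ (by simp) ?_).2
  · filter_upwards [isOpen_Ioo.mem_nhds ht] with s hs
    exact aestronglyMeasurable_uIoc_of_continuousOn hcd
      (continuousOn_right_of_continuousOn_Icc_prod hF (Ioo_subset_Icc_self hs))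
  · exact (continuousOn_right_of_continuousOn_Icc_prod hF htI).intervalIntegrable_of_Icc hcd
  · exact aestronglyMeasurable_uIoc_of_continuousOn hcd
      (continuousOn_right_of_continuousOn_Icc_prod hF' htI)
  · exact Filter.Eventually.of_forall fun x hx s hs =>
      hC s (Ioo_subset_Icc_self hs) x (hsub hx)
  · exact Filter.Eventually.of_forall fun x hx s hs =>
      hd s (Ioo_subset_Icc_self hs) x (hsub hx)

/-- Grönwall's inequality in differential form, with the differential inequality only required
at interior points. -/
lemma le_mul_exp_of_deriv_le_mul {f f' : ℝ → ℝ} {k T : ℝ} (hf : ContinuousOn f (Icc 0 T))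
    (hd : ∀ t ∈ Ioo 0 T, HasDerivAt f (f' t) t) (hle : ∀ t ∈ Ioo 0 T, f' t ≤ k * f t)
    {t : ℝ} (ht : t ∈ Icc 0 T) : f t ≤ f 0 * exp (k * t) := by
  have hg : ∀ t ∈ Ioo 0 T, HasDerivAt (fun s => f s * exp (-(k * s)))
      (f' t * exp (-(k * t)) + f t * (exp (-(k * t)) * -k)) t := fun s hs =>
    (hd s hs).mul (by simpa using (((hasDerivAt_id s).const_mul k).neg).exp)
  have hanti : AntitoneOn (fun s => f s * exp (-(k * s))) (Icc 0 T) := by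
    refine antitoneOn_of_deriv_nonpos (convex_Icc 0 T) (hf.mul (by fun_prop)) ?_ ?_
    · rw [interior_Icc]
      exact fun s hs => (hg s hs).differentiableAt.differentiableWithinAt
    · rw [interior_Icc]
      intro s hs
      rw [(hg s hs).deriv]
      nlinarith [hle s hs, exp_pos (-(k * s))]
  have h := hanti (left_mem_Icc.2 (ht.1.trans ht.2)) ht ht.1
  simp only [mul_zero, neg_zero, exp_zero, mul_one, exp_neg] at h
  rwa [← div_eq_mul_inv, div_le_iff₀ (exp_pos _)] at h

/-- exponential decay of the Lyapunov functional for the forward system with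
homogeneous boundary conditions: if `μ₊ > 0`, `μ₋ > 0`, `ν_a < 0` satisfy
`vᵀ[E'D + ED' − |η₀|(EM + MᵀE)]v ≤ ν_a vᵀ E v` for all `x ∈ [0,L]`, `v ∈ ℝ²`, and `r` is a
`C¹` solution of `r_t + D r_x = η₀ M r` with `r₊(t,0) = 0`, `r₋(t,L) = 0`, then
`E₁(t) ≤ E₁(0) exp(ν_a t)` for `E₁(t) = (1/2)∫_0^L rᵀ E r dx`. -/
theorem stmt10
    (L T : ℝ) (hL : 0 < L) (hT : 0 < T)
    (dp dm dp' dm' : ℝ → ℝ)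
    (hdp : ∀ x ∈ Icc (0 : ℝ) L, HasDerivAt dp (dp' x) x)
    (hdm : ∀ x ∈ Icc (0 : ℝ) L, HasDerivAt dm (dm' x) x)
    (hdpc : ContinuousOn dp' (Icc (0 : ℝ) L)) (hdmc : ContinuousOn dm' (Icc (0 : ℝ) L))
    (hsign : ∀ x ∈ Icc (0 : ℝ) L, dm x < 0 ∧ 0 < dp x)
    (M : ℝ → Matrix (Fin 2) (Fin 2) ℝ) (hM : ContinuousOn M (Icc (0 : ℝ) L))
    (η₀ : ℝ) (hη : η₀ ≤ 0)
    (μp μm : ℝ) (hμp : 0 < μp) (hμm : 0 < μm)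
    (νa : ℝ) (hνa : νa < 0)
    (D : ℝ → Matrix (Fin 2) (Fin 2) ℝ) (hD : ∀ x, D x = Matrix.diagonal ![dp x, dm x])
    (D' : ℝ → Matrix (Fin 2) (Fin 2) ℝ) (hD' : ∀ x, D' x = Matrix.diagonal ![dp' x, dm' x])
    (E : ℝ → Matrix (Fin 2) (Fin 2) ℝ)
    (hE : ∀ x, E x = Matrix.diagonal ![exp (-μp * x), exp (μm * x)])
    (E' : ℝ → Matrix (Fin 2) (Fin 2) ℝ)
    (hE' : ∀ x, E' x = Matrix.diagonal ![-μp * exp (-μp * x), μm * exp (μm * x)])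
    (hmat : ∀ x ∈ Icc (0 : ℝ) L, ∀ v : Fin 2 → ℝ,
      v ⬝ᵥ (E' x * D x + E x * D' x - |η₀| • (E x * M x + (M x)ᵀ * E x)).mulVec v
        ≤ νa * (v ⬝ᵥ (E x).mulVec v))
    (r rt rx : ℝ → ℝ → Fin 2 → ℝ)
    (hrt : ∀ t ∈ Icc (0 : ℝ) T, ∀ x ∈ Icc (0 : ℝ) L,
      HasDerivAt (fun s => r s x) (rt t x) t)
    (hrx : ∀ t ∈ Icc (0 : ℝ) T, ∀ x ∈ Icc (0 : ℝ) L,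
      HasDerivAt (fun y => r t y) (rx t x) x)
    (hrc : ContinuousOn (fun p : ℝ × ℝ => r p.1 p.2) (Icc 0 T ×ˢ Icc 0 L))
    (hrtc : ContinuousOn (fun p : ℝ × ℝ => rt p.1 p.2) (Icc 0 T ×ˢ Icc 0 L))
    (hrxc : ContinuousOn (fun p : ℝ × ℝ => rx p.1 p.2) (Icc 0 T ×ˢ Icc 0 L))
    (hpde : ∀ t ∈ Icc (0 : ℝ) T, ∀ x ∈ Icc (0 : ℝ) L,
      rt t x + (D x).mulVec (rx t x) = η₀ • (M x).mulVec (r t x))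
    (hbc0 : ∀ t ∈ Icc (0 : ℝ) T, r t 0 0 = 0)
    (hbcL : ∀ t ∈ Icc (0 : ℝ) T, r t L 1 = 0)
    (E₁ : ℝ → ℝ)
    (hE₁ : ∀ t, E₁ t = (1 / 2) * ∫ x in (0 : ℝ)..L, r t x ⬝ᵥ (E x).mulVec (r t x)) :
    ∀ t ∈ Icc (0 : ℝ) T, E₁ t ≤ E₁ 0 * exp (νa * t) := by
  have hr0 : ContinuousOn (fun p : ℝ × ℝ => r p.1 p.2 0) (Icc 0 T ×ˢ Icc 0 L) :=
    (continuous_apply 0).comp_continuousOn hrc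
  have hr1 : ContinuousOn (fun p : ℝ × ℝ => r p.1 p.2 1) (Icc 0 T ×ˢ Icc 0 L) :=
    (continuous_apply 1).comp_continuousOn hrc
  have hrt0 : ContinuousOn (fun p : ℝ × ℝ => rt p.1 p.2 0) (Icc 0 T ×ˢ Icc 0 L) :=
    (continuous_apply 0).comp_continuousOn hrtc
  have hrt1 : ContinuousOn (fun p : ℝ × ℝ => rt p.1 p.2 1) (Icc 0 T ×ˢ Icc 0 L) :=
    (continuous_apply 1).comp_continuousOn hrtc
  have hrx0 : ContinuousOn (fun p : ℝ × ℝ => rx p.1 p.2 0) (Icc 0 T ×ˢ Icc 0 L) :=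
    (continuous_apply 0).comp_continuousOn hrxc
  have hrx1 : ContinuousOn (fun p : ℝ × ℝ => rx p.1 p.2 1) (Icc 0 T ×ˢ Icc 0 L) :=
    (continuous_apply 1).comp_continuousOn hrxc
  set q : ℝ → ℝ → ℝ := fun t x =>
    exp (-μp * x) * r t x 0 ^ 2 + exp (μm * x) * r t x 1 ^ 2 with hq
  set qt : ℝ → ℝ → ℝ := fun t x =>
    exp (-μp * x) * (2 * r t x 0 * rt t x 0) + exp (μm * x) * (2 * r t x 1 * rt t x 1) with hqt
  set w : ℝ → ℝ → ℝ := fun t x =>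
    exp (-μp * x) * dp x * r t x 0 ^ 2 + exp (μm * x) * dm x * r t x 1 ^ 2 with hw
  set wx : ℝ → ℝ → ℝ := fun t x =>
    (exp (-μp * x) * -μp * dp x + exp (-μp * x) * dp' x) * r t x 0 ^ 2
      + exp (-μp * x) * dp x * (2 * r t x 0 * rx t x 0)
      + ((exp (μm * x) * μm * dm x + exp (μm * x) * dm' x) * r t x 1 ^ 2
      + exp (μm * x) * dm x * (2 * r t x 1 * rx t x 1)) with hwx
  have hqc : ContinuousOn (fun p : ℝ × ℝ => q p.1 p.2) (Icc 0 T ×ˢ Icc 0 L) := by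
    simp only [hq]; fun_prop
  have hqtc : ContinuousOn (fun p : ℝ × ℝ => qt p.1 p.2) (Icc 0 T ×ˢ Icc 0 L) := by
    simp only [hqt]; fun_prop
  have hqd : ∀ t ∈ Icc (0 : ℝ) T, ∀ x ∈ Icc (0 : ℝ) L,
      HasDerivAt (fun s => q s x) (qt t x) t := by
    intro t ht x hx
    have h := hasDerivAt_pi.1 (hrt t ht x hx)
    have h' := (((h 0).fun_pow 2).const_mul (exp (-μp * x))).fun_add
      (((h 1).fun_pow 2).const_mul (exp (μm * x)))
    refine h'.congr_deriv ?_
    simp [hqt]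
  have hwd : ∀ t ∈ Icc (0 : ℝ) T, ∀ x ∈ Icc (0 : ℝ) L, HasDerivAt (w t) (wx t x) x := by
    intro t ht x hx
    have h := hasDerivAt_pi.1 (hrx t ht x hx)
    have hep : HasDerivAt (fun y => exp (-μp * y)) (exp (-μp * x) * -μp) x := by
      simpa using ((hasDerivAt_id x).const_mul (-μp)).exp
    have hem : HasDerivAt (fun y => exp (μm * y)) (exp (μm * x) * μm) x := by
      simpa using ((hasDerivAt_id x).const_mul μm).exp
    have h' := ((hep.fun_mul (hdp x hx)).fun_mul ((h 0).fun_pow 2)).fun_add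
      ((hem.fun_mul (hdm x hx)).fun_mul ((h 1).fun_pow 2))
    refine h'.congr_deriv ?_
    simp [hwx]
  have hdpc₀ : ContinuousOn dp (Icc 0 L) := fun x hx =>
    (hdp x hx).continuousAt.continuousWithinAt
  have hdmc₀ : ContinuousOn dm (Icc 0 L) := fun x hx =>
    (hdm x hx).continuousAt.continuousWithinAt
  have hwxc : ∀ t ∈ Icc (0 : ℝ) T, ContinuousOn (wx t) (Icc 0 L) := by
    intro t ht
    have h0 := continuousOn_right_of_continuousOn_Icc_prod (F := fun t x => r t x 0) hr0 ht
    have h1 := continuousOn_right_of_continuousOn_Icc_prod (F := fun t x => r t x 1) hr1 ht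
    have h2 := continuousOn_right_of_continuousOn_Icc_prod (F := fun t x => rx t x 0) hrx0 ht
    have h3 := continuousOn_right_of_continuousOn_Icc_prod (F := fun t x => rx t x 1) hrx1 ht
    simp only [hwx]
    fun_prop
  have hpoint : ∀ t ∈ Icc (0 : ℝ) T, ∀ x ∈ Icc (0 : ℝ) L,
      qt t x ≤ νa * q t x - wx t x := by
    intro t ht x hx
    have hm := hmat x hx (r t x)
    have hp0 := congrFun (hpde t ht x hx) 0
    have hp1 := congrFun (hpde t ht x hx) 1
    simp [hD, hE, hE', hD', Matrix.mulVec, dotProduct, Matrix.mul_apply, Fin.sum_univ_two,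
      abs_of_nonpos hη] at hm hp0 hp1
    rw [← eq_sub_iff_add_eq] at hp0 hp1
    simp only [hq, hqt, hwx, hp0, hp1]
    simp only [neg_mul]
    linarith
  have hdecay : ∀ t ∈ Icc (0 : ℝ) T, ∫ x in (0 : ℝ)..L, qt t x ≤
      νa * ∫ x in (0 : ℝ)..L, q t x := by
    intro t ht
    have hqi := (continuousOn_right_of_continuousOn_Icc_prod hqc ht).intervalIntegrable_of_Icc
      (μ := MeasureTheory.volume) hL.le
    have hqti := (continuousOn_right_of_continuousOn_Icc_prod hqtc ht).intervalIntegrable_of_Icc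
      (μ := MeasureTheory.volume) hL.le
    have hwxi := (hwxc t ht).intervalIntegrable_of_Icc (μ := MeasureTheory.volume) hL.le
    have hftc : ∫ x in (0 : ℝ)..L, wx t x = w t L - w t 0 :=
      intervalIntegral.integral_eq_sub_of_hasDerivAt
        (fun x hx => hwd t ht x (by rwa [uIcc_of_le hL.le] at hx)) hwxi
    have hmono := intervalIntegral.integral_mono_on hL.le hqti
      ((hqi.const_mul νa).sub hwxi) (hpoint t ht)
    rw [intervalIntegral.integral_sub (hqi.const_mul νa) hwxi,
      intervalIntegral.integral_const_mul, hftc] at hmono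
    have hwL : 0 ≤ w t L := by
      have := (hsign L (right_mem_Icc.2 hL.le)).2
      simp only [hw, hbcL t ht, zero_pow two_ne_zero, mul_zero, add_zero]
      positivity
    have hw0 : w t 0 ≤ 0 := by
      have := (hsign 0 (left_mem_Icc.2 hL.le)).1
      simp only [hw, hbc0 t ht, mul_zero, exp_zero, one_mul, zero_pow two_ne_zero, zero_add]
      nlinarith [sq_nonneg (r t 0 1)]
    linarith
  have hE₁q : ∀ t, E₁ t = (1 / 2) * ∫ x in (0 : ℝ)..L, q t x := by
    intro t
    rw [hE₁]
    congr 2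
    ext x
    simp only [hE, hq, Matrix.mulVec_diagonal, dotProduct, Fin.sum_univ_two]
    simp
    ring
  intro t ht
  have h := le_mul_exp_of_deriv_le_mul (continuousOn_parametric_integral_Icc hL.le hqc)
    (fun s hs => hasDerivAt_parametric_integral_Ioo hL.le hqc hqtc hqd hs)
    (fun s hs => hdecay s (Ioo_subset_Icc_self hs)) ht
  rw [hE₁q, hE₁q]
  linarith
end

section
/- Let t ∈ ℝ and let f : [t−1, t] × [0,L] → ℝ² be continuously differentiable, solve the adjoint system f_s + D(x) f_x = −η₀ M(x)ᵀ f − D'(x) f, satisfy f₊(s, L) = 0 and f₋(s, 0) = 0 for all s ∈ [t−1, t], and satisfy the terminal condition f(t, x) = y₀(x) for x ∈ [0,L]. Assume there is a constant C̃₂ ≥ 0 such that ∫_{t−1}^{t} ∫_0^L f(s,x)ᵀ ( |η₀| M(x)ᵀ − (1/2) D'(x) ) f(s,x) dx ds ≥ −(C̃₂/2) ∫_0^L ‖y₀(x)‖²_{ℝ²} dx. Then ∫_{t−1}^{t} ( |d₋(L)| f₋(s, L)² + d₊(0) f₊(s, 0)² ) ds ≤ (1 + C̃₂) ∫_0^L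 ‖y₀(x)‖²_{ℝ²} dx. -/
open Set Real Matrix

open MeasureTheory in
/-- The inner integral of a function continuous on a rectangle is integrable in the outer
variable. -/
lemma ContinuousOn.intervalIntegrable_intervalIntegral {F : ℝ → ℝ → ℝ} {a b c d : ℝ}
    (hab : a ≤ b) (hcd : c ≤ d)
    (hF : ContinuousOn (fun p : ℝ × ℝ => F p.1 p.2) (Icc a b ×ˢ Icc c d)) :
    IntervalIntegrable (fun s => ∫ x in c..d, F s x) volume a b := by
  have hint : Integrable (fun p : ℝ × ℝ => F p.1 p.2)
      ((volume.restrict (Ioc a b)).prod (volume.restrict (Ioc c d))) := by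
    rw [Measure.prod_restrict, ← Measure.volume_eq_prod]
    exact (hF.integrableOn_compact (isCompact_Icc.prod isCompact_Icc)).mono_set
      (prod_mono Ioc_subset_Icc_self Ioc_subset_Icc_self)
  rw [intervalIntegrable_iff_integrableOn_Ioc_of_le hab]
  simpa only [intervalIntegral.integral_of_le hcd, IntegrableOn] using hint.integral_prod_left

open MeasureTheory in
/-- Divergence theorem on a rectangle for a pair `P`, `Q` of functions having only the partial
derivatives that enter the divergence. -/
lemma integral_divergence_rectangle {P Q P' Q' : ℝ → ℝ → ℝ} {a b c d : ℝ}
    (hab : a ≤ b) (hcd : c ≤ d)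
    (hP : ∀ s ∈ Icc a b, ∀ x ∈ Icc c d, HasDerivAt (fun σ => P σ x) (P' s x) s)
    (hQ : ∀ s ∈ Icc a b, ∀ x ∈ Icc c d, HasDerivAt (fun y => Q s y) (Q' s x) x)
    (hPc : ContinuousOn (fun p : ℝ × ℝ => P' p.1 p.2) (Icc a b ×ˢ Icc c d))
    (hQc : ContinuousOn (fun p : ℝ × ℝ => Q' p.1 p.2) (Icc a b ×ˢ Icc c d)) :
    ∫ s in a..b, ∫ x in c..d, (P' s x + Q' s x)
      = (∫ x in c..d, (P b x - P a x)) + ∫ s in a..b, (Q s d - Q s c) := by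
  have slice {F : ℝ → ℝ → ℝ}
      (hF : ContinuousOn (fun p : ℝ × ℝ => F p.1 p.2) (Icc a b ×ˢ Icc c d))
      {s : ℝ} (hs : s ∈ Icc a b) : IntervalIntegrable (F s) volume c d :=
    ContinuousOn.intervalIntegrable_of_Icc hcd
      (hF.comp (f := fun x => (s, x)) (by fun_prop) fun x hx => ⟨hs, hx⟩)
  have slice' {x : ℝ} (hx : x ∈ Icc c d) : IntervalIntegrable (fun s => P' s x) volume a b :=
    ContinuousOn.intervalIntegrable_of_Icc hab
      (hPc.comp (f := fun s => (s, x)) (by fun_prop) fun s hs => ⟨hs, hx⟩)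
  have hadd : ∫ s in a..b, ∫ x in c..d, (P' s x + Q' s x)
      = ∫ s in a..b, ((∫ x in c..d, P' s x) + ∫ x in c..d, Q' s x) := by
    refine intervalIntegral.integral_congr fun s hs => ?_
    rw [uIcc_of_le hab] at hs
    exact intervalIntegral.integral_add (slice hPc hs) (slice hQc hs)
  have hswap : ∫ s in a..b, ∫ x in c..d, P' s x = ∫ x in c..d, ∫ s in a..b, P' s x := by
    refine intervalIntegral_intervalIntegral_swap ?_
    rw [uIoc_of_le hab, uIoc_of_le hcd]
    exact (hPc.integrableOn_compact (isCompact_Icc.prod isCompact_Icc)).mono_set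
      (prod_mono Ioc_subset_Icc_self Ioc_subset_Icc_self)
  rw [hadd, intervalIntegral.integral_add (hPc.intervalIntegrable_intervalIntegral hab hcd)
    (hQc.intervalIntegrable_intervalIntegral hab hcd), hswap]
  congr 1
  · refine intervalIntegral.integral_congr fun x hx => ?_
    rw [uIcc_of_le hcd] at hx
    refine intervalIntegral.integral_eq_sub_of_hasDerivAt (f := fun s => P s x)
      (fun s hs => ?_) (slice' hx)
    rw [uIcc_of_le hab] at hs
    exact hP s hs x hx
  · refine intervalIntegral.integral_congr fun s hs => ?_
    rw [uIcc_of_le hab] at hs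
    refine intervalIntegral.integral_eq_sub_of_hasDerivAt (fun x hx => ?_) (slice hQc hs)
    rw [uIcc_of_le hcd] at hx
    exact hQ s hs x hx

/-- inequality (42) of Lemma 6, hidden regularity for the adjoint system:
if `f` is a `C¹` solution of `f_s + D f_x = −η₀ Mᵀ f − D' f` on `[t−1,t] × [0,L]` with
`f₊(s,L) = 0`, `f₋(s,0) = 0`, terminal data `f(t,·) = y₀`, and
`∫∫ fᵀ(|η₀|Mᵀ − (1/2)D')f ≥ −(C̃₂/2)∫‖y₀‖²`, then
`∫_{t−1}^{t} (|d₋(L)| f₋(s,L)² + d₊(0) f₊(s,0)²) ds ≤ (1 + C̃₂) ∫_0^L ‖y₀(x)‖² dx`. -/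
theorem stmt12
    (L : ℝ) (hL : 0 < L) (t : ℝ)
    (dp dm dp' dm' : ℝ → ℝ)
    (hdp : ∀ x ∈ Icc (0 : ℝ) L, HasDerivAt dp (dp' x) x)
    (hdm : ∀ x ∈ Icc (0 : ℝ) L, HasDerivAt dm (dm' x) x)
    (hdpc : ContinuousOn dp' (Icc (0 : ℝ) L)) (hdmc : ContinuousOn dm' (Icc (0 : ℝ) L))
    (hsign : ∀ x ∈ Icc (0 : ℝ) L, dm x < 0 ∧ 0 < dp x)
    (M : ℝ → Matrix (Fin 2) (Fin 2) ℝ) (hM : ContinuousOn M (Icc (0 : ℝ) L))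
    (η₀ : ℝ) (hη : η₀ ≤ 0)
    (D : ℝ → Matrix (Fin 2) (Fin 2) ℝ) (hD : ∀ x, D x = Matrix.diagonal ![dp x, dm x])
    (D' : ℝ → Matrix (Fin 2) (Fin 2) ℝ) (hD' : ∀ x, D' x = Matrix.diagonal ![dp' x, dm' x])
    (f ft fx : ℝ → ℝ → Fin 2 → ℝ) (y₀ : ℝ → Fin 2 → ℝ)
    (hft : ∀ s ∈ Icc (t - 1) t, ∀ x ∈ Icc (0 : ℝ) L,
      HasDerivAt (fun σ => f σ x) (ft s x) s)
    (hfx : ∀ s ∈ Icc (t - 1) t, ∀ x ∈ Icc (0 : ℝ) L,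
      HasDerivAt (fun y => f s y) (fx s x) x)
    (hfc : ContinuousOn (fun p : ℝ × ℝ => f p.1 p.2) (Icc (t - 1) t ×ˢ Icc 0 L))
    (hftc : ContinuousOn (fun p : ℝ × ℝ => ft p.1 p.2) (Icc (t - 1) t ×ˢ Icc 0 L))
    (hfxc : ContinuousOn (fun p : ℝ × ℝ => fx p.1 p.2) (Icc (t - 1) t ×ˢ Icc 0 L))
    (hpde : ∀ s ∈ Icc (t - 1) t, ∀ x ∈ Icc (0 : ℝ) L,
      ft s x + (D x).mulVec (fx s x)
        = (-η₀) • (M x)ᵀ.mulVec (f s x) - (D' x).mulVec (f s x))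
    (hbcL : ∀ s ∈ Icc (t - 1) t, f s L 0 = 0)
    (hbc0 : ∀ s ∈ Icc (t - 1) t, f s 0 1 = 0)
    (hterm : ∀ x ∈ Icc (0 : ℝ) L, f t x = y₀ x)
    (C₂ : ℝ) (hC₂ : 0 ≤ C₂)
    (hlow : ∫ s in (t - 1)..t, ∫ x in (0 : ℝ)..L,
        f s x ⬝ᵥ (|η₀| • (M x)ᵀ - (1 / 2 : ℝ) • D' x).mulVec (f s x)
      ≥ -(C₂ / 2) * ∫ x in (0 : ℝ)..L, (y₀ x 0 ^ 2 + y₀ x 1 ^ 2)) :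
    ∫ s in (t - 1)..t, (|dm L| * (f s L 1) ^ 2 + dp 0 * (f s 0 0) ^ 2)
      ≤ (1 + C₂) * ∫ x in (0 : ℝ)..L, (y₀ x 0 ^ 2 + y₀ x 1 ^ 2) := by
  have hts : t - 1 ≤ t := by linarith
  have ht : t ∈ Icc (t - 1) t := right_mem_Icc.2 hts
  have ht' : t - 1 ∈ Icc (t - 1) t := left_mem_Icc.2 hts
  have h0 : (0 : ℝ) ∈ Icc 0 L := left_mem_Icc.2 hL.le
  have hL' : L ∈ Icc (0 : ℝ) L := right_mem_Icc.2 hL.le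
  have hft' := fun s hs x hx => hasDerivAt_pi.1 (hft s hs x hx)
  have hfx' := fun s hs x hx => hasDerivAt_pi.1 (hfx s hs x hx)
  have hfci := continuousOn_pi.1 hfc
  have hftci := continuousOn_pi.1 hftc
  have hfxci := continuousOn_pi.1 hfxc
  have lift {g : ℝ → ℝ} (hg : ContinuousOn g (Icc 0 L)) :
      ContinuousOn (fun p : ℝ × ℝ => g p.2) (Icc (t - 1) t ×ˢ Icc 0 L) :=
    hg.comp continuousOn_snd fun p hp => hp.2
  have hdpc₀ := lift fun x hx => (hdp x hx).continuousAt.continuousWithinAt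
  have hdmc₀ := lift fun x hx => (hdm x hx).continuousAt.continuousWithinAt
  have key := integral_divergence_rectangle
    (P := fun s x => f s x 0 ^ 2 + f s x 1 ^ 2)
    (Q := fun s x => dp x * f s x 0 ^ 2 + dm x * f s x 1 ^ 2)
    (P' := fun s x => 2 * f s x 0 * ft s x 0 + 2 * f s x 1 * ft s x 1)
    (Q' := fun s x => (dp' x * f s x 0 ^ 2 + dp x * (2 * f s x 0 * fx s x 0))
      + (dm' x * f s x 1 ^ 2 + dm x * (2 * f s x 1 * fx s x 1)))
    hts hL.le
    (fun s hs x hx => by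
      have h (i : Fin 2) := (hft' s hs x hx i).pow 2
      exact ((h 0).add (h 1)).congr_deriv (by simp))
    (fun s hs x hx => by
      have h (i : Fin 2) := (hfx' s hs x hx i).pow 2
      exact (((hdp x hx).mul (h 0)).add ((hdm x hx).mul (h 1))).congr_deriv (by simp))
    ((((hfci 0).const_mul 2).mul (hftci 0)).add (((hfci 1).const_mul 2).mul (hftci 1)))
    ((((lift hdpc).mul ((hfci 0).pow 2)).add
        (hdpc₀.mul (((hfci 0).const_mul 2).mul (hfxci 0)))).add
      (((lift hdmc).mul ((hfci 1).pow 2)).add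
        (hdmc₀.mul (((hfci 1).const_mul 2).mul (hfxci 1)))))
  have hsource : ∫ s in (t - 1)..t, ∫ x in (0 : ℝ)..L,
      ((2 * f s x 0 * ft s x 0 + 2 * f s x 1 * ft s x 1)
        + ((dp' x * f s x 0 ^ 2 + dp x * (2 * f s x 0 * fx s x 0))
          + (dm' x * f s x 1 ^ 2 + dm x * (2 * f s x 1 * fx s x 1))))
      = 2 * ∫ s in (t - 1)..t, ∫ x in (0 : ℝ)..L,
        f s x ⬝ᵥ (|η₀| • (M x)ᵀ - (1 / 2 : ℝ) • D' x).mulVec (f s x) := by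
    simp_rw [← intervalIntegral.integral_const_mul]
    refine intervalIntegral.integral_congr fun s hs =>
      intervalIntegral.integral_congr fun x hx => ?_
    rw [uIcc_of_le hts] at hs
    rw [uIcc_of_le hL.le] at hx
    have e0 := congrFun (hpde s hs x hx) 0
    have e1 := congrFun (hpde s hs x hx) 1
    simp [hD, hD', Matrix.mulVec, dotProduct, Fin.sum_univ_two, abs_of_nonpos hη,
      Matrix.diagonal] at e0 e1 ⊢
    linear_combination 2 * f s x 0 * e0 + 2 * f s x 1 * e1
  have hslice {s : ℝ} (hs : s ∈ Icc (t - 1) t) :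
      IntervalIntegrable (fun x => f s x 0 ^ 2 + f s x 1 ^ 2) MeasureTheory.volume 0 L :=
    ContinuousOn.intervalIntegrable_of_Icc hL.le
      ((((hfci 0).pow 2).add ((hfci 1).pow 2)).comp (f := fun x => (s, x)) (by fun_prop)
        fun x hx => ⟨hs, hx⟩)
  have hboundary : ∫ s in (t - 1)..t, ((dp L * f s L 0 ^ 2 + dm L * f s L 1 ^ 2)
        - (dp 0 * f s 0 0 ^ 2 + dm 0 * f s 0 1 ^ 2))
      = -∫ s in (t - 1)..t, (|dm L| * (f s L 1) ^ 2 + dp 0 * (f s 0 0) ^ 2) := by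
    rw [← intervalIntegral.integral_neg]
    refine intervalIntegral.integral_congr fun s hs => ?_
    rw [uIcc_of_le hts] at hs
    simp only [hbcL s hs, hbc0 s hs, abs_of_neg (hsign L hL').1]
    ring
  have hterminal : ∫ x in (0 : ℝ)..L, (f t x 0 ^ 2 + f t x 1 ^ 2)
      = ∫ x in (0 : ℝ)..L, (y₀ x 0 ^ 2 + y₀ x 1 ^ 2) := by
    refine intervalIntegral.integral_congr fun x hx => ?_
    rw [uIcc_of_le hL.le] at hx
    simp only [hterm x hx]
  have hinitial : 0 ≤ ∫ x in (0 : ℝ)..L, (f (t - 1) x 0 ^ 2 + f (t - 1) x 1 ^ 2) :=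
    intervalIntegral.integral_nonneg hL.le fun x _ => by positivity
  rw [hsource, intervalIntegral.integral_sub (hslice ht) (hslice ht'), hterminal,
    hboundary] at key
  linarith
end

section
/- Let t ∈ ℝ and let g : [t, t+1] × [0,L] → ℝ² be continuously differentiable, solve the forward system g_s + D(x) g_x = η₀ M(x) g, satisfy g₊(s, 0) = 0 and g₋(s, L) = 0 for all s ∈ [t, t+1], and satisfy the initial condition g(t, x) = y₀(x) for x ∈ [0,L]. Assume there is a constant C̃₃ ≥ 0 such that ∫_{t}^{t+1} ∫_0^L g(s,x)ᵀ ( η₀ M(x) + (1/2) D'(x) ) g(s,x) dx ds ≤ (C̃₃/2) ∫_0^L ‖y₀(x)‖²_{ℝ²} dx. Then ∫_{t}^{t+1} ( |d₋(0)| g₋(s, 0)² + d₊(L) g₊(s, L)² ) ds ≤ (1 + C̃₃) ∫_0^L ‖y₀(x)‖²_{ℝ²} dx. -/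
open Set Real Matrix

open MeasureTheory in
/-- Integrating a partial derivative in the first variable over a rectangle. -/
theorem integral_integral_partial_deriv_left {a b c d : ℝ} (hab : a ≤ b) (hcd : c ≤ d)
    {u v : ℝ → ℝ → ℝ}
    (huv : ∀ s ∈ Icc a b, ∀ x ∈ Icc c d, HasDerivAt (fun σ => u σ x) (v s x) s)
    (hv : ContinuousOn (fun p : ℝ × ℝ => v p.1 p.2) (Icc a b ×ˢ Icc c d)) :
    IntervalIntegrable (fun s => ∫ x in c..d, v s x) volume a b ∧
      ∫ s in a..b, ∫ x in c..d, v s x = ∫ x in c..d, (u b x - u a x) := by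
  have hint : IntegrableOn (Function.uncurry v) (Icc a b ×ˢ Icc c d) (volume.prod volume) :=
    hv.integrableOn_compact (isCompact_Icc.prod isCompact_Icc)
  have hint' : Integrable (Function.uncurry v)
      ((volume.restrict (Ioc a b)).prod (volume.restrict (Ioc c d))) := by
    rw [Measure.prod_restrict]
    exact hint.mono_set (prod_mono Ioc_subset_Icc_self Ioc_subset_Icc_self)
  constructor
  · rw [intervalIntegrable_iff_integrableOn_Ioc_of_le hab]
    simp only [intervalIntegral.integral_of_le hcd]
    exact hint'.integral_prod_left
  · have hswap : ∫ s in a..b, ∫ x in c..d, v s x = ∫ x in c..d, ∫ s in a..b, v s x := by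
      simp only [intervalIntegral.integral_of_le hcd, intervalIntegral.integral_of_le hab]
      exact integral_integral_swap hint'
    rw [hswap]
    refine intervalIntegral.integral_congr fun x hx => ?_
    rw [uIcc_of_le hcd] at hx
    refine intervalIntegral.integral_eq_sub_of_hasDerivAt (f := fun σ => u σ x)
      (fun s hs => huv s (by rwa [uIcc_of_le hab] at hs) x hx) ?_
    refine ContinuousOn.intervalIntegrable_of_Icc hab ?_
    exact hv.comp (f := fun s => (s, x)) (by fun_prop) fun s hs => ⟨hs, hx⟩

/-- inequality (44) of Lemma 6, hidden regularity for the forward system: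
if `g` is a `C¹` solution of `g_s + D g_x = η₀ M g` on `[t,t+1] × [0,L]` with
`g₊(s,0) = 0`, `g₋(s,L) = 0`, initial data `g(t,·) = y₀`, and
`∫∫ gᵀ(η₀ M + (1/2)D')g ≤ (C̃₃/2)∫‖y₀‖²`, then
`∫_{t}^{t+1} (|d₋(0)| g₋(s,0)² + d₊(L) g₊(s,L)²) ds ≤ (1 + C̃₃) ∫_0^L ‖y₀(x)‖² dx`. -/
theorem stmt13
    (L : ℝ) (hL : 0 < L) (t : ℝ)
    (dp dm dp' dm' : ℝ → ℝ)
    (hdp : ∀ x ∈ Icc (0 : ℝ) L, HasDerivAt dp (dp' x) x)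
    (hdm : ∀ x ∈ Icc (0 : ℝ) L, HasDerivAt dm (dm' x) x)
    (hdpc : ContinuousOn dp' (Icc (0 : ℝ) L)) (hdmc : ContinuousOn dm' (Icc (0 : ℝ) L))
    (hsign : ∀ x ∈ Icc (0 : ℝ) L, dm x < 0 ∧ 0 < dp x)
    (M : ℝ → Matrix (Fin 2) (Fin 2) ℝ) (hM : ContinuousOn M (Icc (0 : ℝ) L))
    (η₀ : ℝ) (hη : η₀ ≤ 0)
    (D : ℝ → Matrix (Fin 2) (Fin 2) ℝ) (hD : ∀ x, D x = Matrix.diagonal ![dp x, dm x])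
    (D' : ℝ → Matrix (Fin 2) (Fin 2) ℝ) (hD' : ∀ x, D' x = Matrix.diagonal ![dp' x, dm' x])
    (g gt gx : ℝ → ℝ → Fin 2 → ℝ) (y₀ : ℝ → Fin 2 → ℝ)
    (hgt : ∀ s ∈ Icc t (t + 1), ∀ x ∈ Icc (0 : ℝ) L,
      HasDerivAt (fun σ => g σ x) (gt s x) s)
    (hgx : ∀ s ∈ Icc t (t + 1), ∀ x ∈ Icc (0 : ℝ) L,
      HasDerivAt (fun y => g s y) (gx s x) x)
    (hgc : ContinuousOn (fun p : ℝ × ℝ => g p.1 p.2) (Icc t (t + 1) ×ˢ Icc 0 L))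
    (hgtc : ContinuousOn (fun p : ℝ × ℝ => gt p.1 p.2) (Icc t (t + 1) ×ˢ Icc 0 L))
    (hgxc : ContinuousOn (fun p : ℝ × ℝ => gx p.1 p.2) (Icc t (t + 1) ×ˢ Icc 0 L))
    (hpde : ∀ s ∈ Icc t (t + 1), ∀ x ∈ Icc (0 : ℝ) L,
      gt s x + (D x).mulVec (gx s x) = η₀ • (M x).mulVec (g s x))
    (hbc0 : ∀ s ∈ Icc t (t + 1), g s 0 0 = 0)
    (hbcL : ∀ s ∈ Icc t (t + 1), g s L 1 = 0)
    (hinit : ∀ x ∈ Icc (0 : ℝ) L, g t x = y₀ x)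
    (C₃ : ℝ) (hC₃ : 0 ≤ C₃)
    (hup : ∫ s in t..(t + 1), ∫ x in (0 : ℝ)..L,
        g s x ⬝ᵥ (η₀ • M x + (1 / 2 : ℝ) • D' x).mulVec (g s x)
      ≤ (C₃ / 2) * ∫ x in (0 : ℝ)..L, (y₀ x 0 ^ 2 + y₀ x 1 ^ 2)) :
    ∫ s in t..(t + 1), (|dm 0| * (g s 0 1) ^ 2 + dp L * (g s L 0) ^ 2)
      ≤ (1 + C₃) * ∫ x in (0 : ℝ)..L, (y₀ x 0 ^ 2 + y₀ x 1 ^ 2) := by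
  have ht : t ≤ t + 1 := by linarith
  have h0 : (0 : ℝ) ∈ Icc 0 L := ⟨le_rfl, hL.le⟩
  have hLm : L ∈ Icc 0 L := ⟨hL.le, le_rfl⟩
  have htm : t ∈ Icc t (t + 1) := ⟨le_rfl, ht⟩
  have hgci (i : Fin 2) : ContinuousOn (fun p : ℝ × ℝ => g p.1 p.2 i) (Icc t (t + 1) ×ˢ Icc 0 L) :=
    (continuous_apply i).comp_continuousOn hgc
  have hgtci (i : Fin 2) :
      ContinuousOn (fun p : ℝ × ℝ => gt p.1 p.2 i) (Icc t (t + 1) ×ˢ Icc 0 L) :=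
    (continuous_apply i).comp_continuousOn hgtc
  have hgxci (i : Fin 2) :
      ContinuousOn (fun p : ℝ × ℝ => gx p.1 p.2 i) (Icc t (t + 1) ×ˢ Icc 0 L) :=
    (continuous_apply i).comp_continuousOn hgxc
  have hslice {f : ℝ × ℝ → ℝ} (hf : ContinuousOn f (Icc t (t + 1) ×ˢ Icc 0 L))
      {s : ℝ} (hs : s ∈ Icc t (t + 1)) : ContinuousOn (fun x => f (s, x)) (Icc 0 L) :=
    hf.comp (f := fun x => (s, x)) (by fun_prop) fun x hx => ⟨hs, hx⟩
  have hcol {f : ℝ × ℝ → ℝ} (hf : ContinuousOn f (Icc t (t + 1) ×ˢ Icc 0 L))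
      {x : ℝ} (hx : x ∈ Icc 0 L) : ContinuousOn (fun s => f (s, x)) (Icc t (t + 1)) :=
    hf.comp (f := fun s => (s, x)) (by fun_prop) fun s hs => ⟨hs, hx⟩
  have hdpcont : ContinuousOn dp (Icc 0 L) := fun x hx =>
    (hdp x hx).continuousAt.continuousWithinAt
  have hdmcont : ContinuousOn dm (Icc 0 L) := fun x hx =>
    (hdm x hx).continuousAt.continuousWithinAt
  let e : ℝ → ℝ → ℝ := fun s x => g s x 0 ^ 2 + g s x 1 ^ 2
  let et : ℝ → ℝ → ℝ := fun s x => 2 * (g s x 0 * gt s x 0 + g s x 1 * gt s x 1)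
  let φ : ℝ → ℝ → ℝ := fun s x => dp x * g s x 0 ^ 2 + dm x * g s x 1 ^ 2
  let φx : ℝ → ℝ → ℝ := fun s x => dp' x * g s x 0 ^ 2 + dm' x * g s x 1 ^ 2 +
    2 * (dp x * (g s x 0 * gx s x 0) + dm x * (g s x 1 * gx s x 1))
  have het_cont : ContinuousOn (fun p : ℝ × ℝ => et p.1 p.2) (Icc t (t + 1) ×ˢ Icc 0 L) :=
    (((hgci 0).mul (hgtci 0)).add ((hgci 1).mul (hgtci 1))).const_mul 2
  have he (s) (hs : s ∈ Icc t (t + 1)) (x) (hx : x ∈ Icc 0 L) :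
      HasDerivAt (fun σ => e σ x) (et s x) s := by
    have h := hasDerivAt_pi.1 (hgt s hs x hx)
    refine (((h 0).pow 2).add ((h 1).pow 2)).congr_deriv ?_
    simp [et]
    ring
  have hφ (s) (hs : s ∈ Icc t (t + 1)) (x) (hx : x ∈ Icc 0 L) :
      HasDerivAt (φ s) (φx s x) x := by
    have h := hasDerivAt_pi.1 (hgx s hs x hx)
    refine (((hdp x hx).mul ((h 0).pow 2)).add
      ((hdm x hx).mul ((h 1).pow 2))).congr_deriv ?_
    simp [φx]
    ring
  have hφx_cont (s) (hs : s ∈ Icc t (t + 1)) : ContinuousOn (φx s) (Icc 0 L) := by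
    have a0 := hslice (hgci 0) hs
    have a1 := hslice (hgci 1) hs
    have b0 := hslice (hgxci 0) hs
    have b1 := hslice (hgxci 1) hs
    simp only at a0 a1 b0 b1
    exact ((hdpc.mul (a0.pow 2)).add (hdmc.mul (a1.pow 2))).add
      (((hdpcont.mul (a0.mul b0)).add (hdmcont.mul (a1.mul b1))).const_mul 2)
  have hflux (s) (hs : s ∈ Icc t (t + 1)) :
      ∫ x in (0 : ℝ)..L, φx s x = |dm 0| * g s 0 1 ^ 2 + dp L * g s L 0 ^ 2 := by
    rw [intervalIntegral.integral_eq_sub_of_hasDerivAt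
      (fun x hx => hφ s hs x (by rwa [uIcc_of_le hL.le] at hx))
      ((hφx_cont s hs).intervalIntegrable_of_Icc hL.le)]
    simp only [φ, hbc0 s hs, hbcL s hs, abs_of_neg (hsign 0 h0).1]
    ring
  have hquad (s) (hs : s ∈ Icc t (t + 1)) (x) (hx : x ∈ Icc 0 L) :
      g s x ⬝ᵥ (η₀ • M x + (1 / 2 : ℝ) • D' x).mulVec (g s x)
        = (1 / 2) * (et s x + φx s x) := by
    have p0 := congrFun (hpde s hs x hx) 0
    have p1 := congrFun (hpde s hs x hx) 1
    simp only [hD, mulVec, dotProduct, Fin.sum_univ_two, Pi.add_apply, Pi.smul_apply,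
      smul_eq_mul, diagonal_apply, Matrix.cons_val_zero, Matrix.cons_val_one] at p0 p1
    simp only [hD', mulVec, dotProduct, Fin.sum_univ_two, Matrix.add_apply, Matrix.smul_apply,
      smul_eq_mul, diagonal_apply, Matrix.cons_val_zero, Matrix.cons_val_one, et, φx]
    simp at p0 p1 ⊢
    linear_combination (-g s x 0) * p0 - g s x 1 * p1
  obtain ⟨hEint, hE⟩ := integral_integral_partial_deriv_left ht hL.le he het_cont
  have hBint : IntervalIntegrable (fun s => |dm 0| * g s 0 1 ^ 2 + dp L * g s L 0 ^ 2)
      MeasureTheory.volume t (t + 1) :=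
    ((((hcol (hgci 1) h0).pow 2).const_mul _).add
      (((hcol (hgci 0) hLm).pow 2).const_mul _)).intervalIntegrable_of_Icc ht
  have hbalance : ∫ s in t..(t + 1), ∫ x in (0 : ℝ)..L,
        g s x ⬝ᵥ (η₀ • M x + (1 / 2 : ℝ) • D' x).mulVec (g s x)
      = (1 / 2) * ((∫ s in t..(t + 1), ∫ x in (0 : ℝ)..L, et s x) +
        ∫ s in t..(t + 1), (|dm 0| * g s 0 1 ^ 2 + dp L * g s L 0 ^ 2)) := by
    rw [← intervalIntegral.integral_add hEint hBint, ← intervalIntegral.integral_const_mul]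
    refine intervalIntegral.integral_congr fun s hs => ?_
    rw [uIcc_of_le ht] at hs
    rw [← hflux s hs, ← intervalIntegral.integral_add
      ((hslice het_cont hs).intervalIntegrable_of_Icc hL.le)
      ((hφx_cont s hs).intervalIntegrable_of_Icc hL.le), ← intervalIntegral.integral_const_mul]
    refine intervalIntegral.integral_congr fun x hx => ?_
    rw [uIcc_of_le hL.le] at hx
    exact hquad s hs x hx
  have he_int (s) (hs : s ∈ Icc t (t + 1)) :
      IntervalIntegrable (e s) MeasureTheory.volume 0 L :=
    ((((hslice (hgci 0) hs).pow 2)).add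
      ((hslice (hgci 1) hs).pow 2)).intervalIntegrable_of_Icc hL.le
  rw [intervalIntegral.integral_sub (he_int _ ⟨ht, le_rfl⟩) (he_int _ htm)] at hE
  have hinit_int : ∫ x in (0 : ℝ)..L, e t x = ∫ x in (0 : ℝ)..L, (y₀ x 0 ^ 2 + y₀ x 1 ^ 2) := by
    refine intervalIntegral.integral_congr fun x hx => ?_
    rw [uIcc_of_le hL.le] at hx
    simp only [e, hinit x hx]
  have hfinal : 0 ≤ ∫ x in (0 : ℝ)..L, e (t + 1) x :=
    intervalIntegral.integral_nonneg hL.le fun x _ => by positivity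
  rw [hbalance, hE, hinit_int] at hup
  linarith
end

section
/- Assume μ₊ > 0, μ₋ > 0 and ν_a < 0 are such that for all x ∈ [0,L] and all v ∈ ℝ²: vᵀ [ E'(x) D(x) + E(x) D'(x) − |η₀| ( E(x) M(x) + M(x)ᵀ E(x) ) ] v ≤ ν_a vᵀ E(x) v. Let T > 0, let u = (u₊, u₋) : [0,∞) → ℝ² be continuous with u(t) = 0 for all t ≥ T, let h₀ : [0,L] → ℝ² be continuous, and let r : [0,∞) × [0,L] → ℝ² be continuously differentiable with r(0,x) = h₀(x), r_t + D(x) r_x = η₀ M(x) r, r₊(t,0) = u₊(t) and r₋(t,L) = u₋(t). Set K̃ = max{ |d₋(L)| exp(μ₋ L), d₊(0) } and E_a(t) = (1/2) ∫_t^{t+1} ∫_0^L r(τ,x)ᵀ E(x) r(τ,x) dx dτ. Assume there is C̃₀ ≥ 0 with E_a(0) ≤ C̃₀ ( ∫_0^T ‖u(τ)‖²_{ℝ²} dτ + ∫_0^L ‖h₀(x)‖²_{ℝ²} dx ). Then ∫_0^∞ ∫_0^L r(τ,x)ᵀ E(x) r(τ,x) dx dτ ≤ (2/(1 − exp(ν_a)))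 (C̃₀ + K̃) ( ∫_0^T ‖u(τ)‖²_{ℝ²} dτ + ∫_0^L ‖h₀(x)‖²_{ℝ²} dx ). -/
open Set Real Matrix MeasureTheory

/-- A Grönwall estimate over one unit of time. -/
lemma dissipation_step {V V' g : ℝ → ℝ} {ν K : ℝ} (hν : ν ≤ 0) (hK : 0 ≤ K)
    (hV : Continuous V) (hg : Continuous g) (hg0 : ∀ t, 0 ≤ g t)
    (hder : ∀ t, 0 < t → HasDerivAt V (V' t) t)
    (hle : ∀ t, 0 < t → V' t ≤ ν * V t + K * g t) {t : ℝ} (ht : 0 ≤ t) :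
    V (t + 1) ≤ exp ν * V t
      + K * ((∫ s in (0 : ℝ)..(t + 1), g s) - ∫ s in (0 : ℝ)..t, g s) := by
  set G : ℝ → ℝ := fun b => ∫ s in (0 : ℝ)..b, g s with hG
  have hGd : ∀ b, HasDerivAt G (g b) b := fun b => hg.integral_hasStrictDerivAt 0 b |>.hasDerivAt
  have hGc : Continuous G := continuous_iff_continuousAt.2 fun b => (hGd b).continuousAt
  have hanti : AntitoneOn (fun s => exp (-ν * (s - t)) * V s - K * exp (-ν) * G s)
      (Icc t (t + 1)) := by
    refine antitoneOn_of_hasDerivWithinAt_nonpos (convex_Icc _ _) (by fun_prop)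
      (f' := fun s => (exp (-ν * (s - t)) * (-ν * 1)) * V s + exp (-ν * (s - t)) * V' s
        - K * exp (-ν) * g s) ?_ ?_
    · intro s hs
      rw [interior_Icc] at hs
      have h1 : HasDerivAt (fun s => -ν * (s - t)) (-ν * 1) s :=
        ((hasDerivAt_id s).sub_const t).const_mul (-ν)
      exact ((h1.exp.mul (hder s (ht.trans_lt hs.1))).sub
        ((hGd s).const_mul (K * exp (-ν)))).hasDerivWithinAt
    · intro s hs
      rw [interior_Icc] at hs
      have h2 : exp (-ν * (s - t)) ≤ exp (-ν) := by
        apply exp_le_exp.2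
        nlinarith [hs.2]
      have h3 := mul_le_mul_of_nonneg_left (hle s (ht.trans_lt hs.1)) (exp_pos (-ν * (s - t))).le
      have h4 := mul_le_mul_of_nonneg_right h2 (mul_nonneg hK (hg0 s))
      nlinarith
  have h := hanti (left_mem_Icc.2 (by linarith)) (right_mem_Icc.2 (by linarith))
    (by linarith : t ≤ t + 1)
  simp only [sub_self, mul_zero, exp_zero, one_mul, add_sub_cancel_left, mul_one] at h
  have h5 := mul_le_mul_of_nonneg_left h (exp_pos ν).le
  have h6 : exp ν * exp (-ν) = 1 := by rw [← exp_add]; simp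
  have e1 : exp ν * (exp (-ν) * V (t + 1) - K * exp (-ν) * G (t + 1))
      = V (t + 1) - K * G (t + 1) := by linear_combination (V (t + 1) - K * G (t + 1)) * h6
  have e2 : exp ν * (V t - K * exp (-ν) * G t) = exp ν * V t - K * G t := by
    linear_combination (-K * G t) * h6
  rw [e1, e2] at h5
  linarith

/-- A nonnegative function dissipated at rate `ν < 0` and driven by a forcing `g` that vanishes
after time `T` has its integral controlled by its integral over one unit of time and that of `g`. -/
lemma integral_Ioi_le_of_dissipation {V V' g : ℝ → ℝ} {ν K T : ℝ} (hν : ν < 0) (hK : 0 ≤ K)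
    (hT : 0 ≤ T) (hV : Continuous V) (hV0 : ∀ t, 0 ≤ V t) (hg : Continuous g)
    (hg0 : ∀ t, 0 ≤ g t) (hgT : ∀ t, T ≤ t → g t = 0)
    (hder : ∀ t, 0 < t → HasDerivAt V (V' t) t)
    (hle : ∀ t, 0 < t → V' t ≤ ν * V t + K * g t) :
    ∫ t in Ioi (0 : ℝ), V t
      ≤ 1 / (1 - exp ν) * ((∫ t in (0 : ℝ)..1, V t) + K * ∫ t in (0 : ℝ)..T, g t) := by
  have hexp : 0 < 1 - exp ν := by have := exp_lt_exp.2 hν; rw [exp_zero] at this; linarith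
  have hU0 : 0 ≤ ∫ t in (0 : ℝ)..T, g t := intervalIntegral.integral_nonneg hT fun t _ => hg0 t
  have hV1 : 0 ≤ ∫ t in (0 : ℝ)..1, V t :=
    intervalIntegral.integral_nonneg zero_le_one fun t _ => hV0 t
  by_cases hint : IntegrableOn V (Ioi 0)
  swap
  · rw [integral_undef hint]
    positivity
  refine le_of_tendsto (intervalIntegral_tendsto_integral_Ioi 0 hint Filter.tendsto_id) ?_
  filter_upwards [Filter.eventually_ge_atTop 0] with N hN
  simp only [id]
  set G : ℝ → ℝ := fun b => ∫ s in (0 : ℝ)..b, g s with hG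
  have hGc : Continuous G := continuous_iff_continuousAt.2 fun b =>
    (hg.integral_hasStrictDerivAt 0 b).hasDerivAt.continuousAt
  have hgi : ∀ a b, IntervalIntegrable g volume a b := fun a b => hg.intervalIntegrable a b
  have hGi : ∀ a b, IntervalIntegrable G volume a b := fun a b => hGc.intervalIntegrable a b
  have hVi : ∀ a b, IntervalIntegrable V volume a b := fun a b => hV.intervalIntegrable a b
  have hG0 : ∀ b, 0 ≤ b → 0 ≤ G b := fun b hb =>
    intervalIntegral.integral_nonneg hb fun t _ => hg0 t
  have hGU : ∀ b, G b ≤ G T := by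
    intro b
    have h1 : G b + ∫ s in b..T, g s = G T :=
      intervalIntegral.integral_add_adjacent_intervals (hgi _ _) (hgi _ _)
    rcases le_total b T with hb | hb
    · have := intervalIntegral.integral_nonneg (μ := volume) hb fun t _ => hg0 t
      linarith
    · have : ∫ s in b..T, g s = 0 := by
        refine intervalIntegral.integral_zero_ae (Filter.Eventually.of_forall fun s hs => ?_)
        rw [uIoc_of_ge hb] at hs
        exact hgT s hs.1.le
      linarith
  have hstep : ∫ t in (0 : ℝ)..N, V (t + 1)
      ≤ ∫ t in (0 : ℝ)..N, (exp ν * V t + K * (G (t + 1) - G t)) := by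
    refine intervalIntegral.integral_mono_on hN (Continuous.intervalIntegrable (by fun_prop) _ _)
      (Continuous.intervalIntegrable (by fun_prop) _ _) fun t ht => ?_
    exact dissipation_step hν.le hK hV hg hg0 hder hle ht.1
  rw [intervalIntegral.integral_add (Continuous.intervalIntegrable (by fun_prop) _ _)
      (Continuous.intervalIntegrable (by fun_prop) _ _), intervalIntegral.integral_const_mul,
    intervalIntegral.integral_const_mul,
    intervalIntegral.integral_sub (Continuous.intervalIntegrable (by fun_prop) _ _) (hGi _ _),
    intervalIntegral.integral_comp_add_right, intervalIntegral.integral_comp_add_right,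
    zero_add] at hstep
  have a1 := intervalIntegral.integral_add_adjacent_intervals (hVi 0 1) (hVi 1 (N + 1))
  have a2 := intervalIntegral.integral_add_adjacent_intervals (hVi 0 N) (hVi N (N + 1))
  have a3 := intervalIntegral.integral_add_adjacent_intervals (hGi 0 1) (hGi 1 (N + 1))
  have a4 := intervalIntegral.integral_add_adjacent_intervals (hGi 0 N) (hGi N (N + 1))
  have b1 : 0 ≤ ∫ t in N..(N + 1), V t :=
    intervalIntegral.integral_nonneg (by linarith) fun t _ => hV0 t
  have b2 : 0 ≤ ∫ t in (0 : ℝ)..1, G t :=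
    intervalIntegral.integral_nonneg zero_le_one fun t ht => hG0 t ht.1
  have b3 : ∫ t in N..(N + 1), G t ≤ G T := by
    have := intervalIntegral.integral_mono_on (by linarith : N ≤ N + 1) (hGi _ _)
      (intervalIntegrable_const (c := G T)) fun t _ => hGU t
    simpa using this
  have hGle : (∫ t in (1 : ℝ)..(N + 1), G t) - ∫ t in (0 : ℝ)..N, G t ≤ G T := by linarith
  have hKG := mul_le_mul_of_nonneg_left hGle hK
  rw [div_mul_eq_mul_div, one_mul, le_div_iff₀ hexp]
  linarith

/-- An integral over `[0, L]` depends continuously on a parameter clipped to `[0, ∞)`. -/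
lemma continuous_integral_max {f : ℝ → ℝ → ℝ} {L : ℝ} (hL : 0 ≤ L)
    (hf : ContinuousOn (fun p : ℝ × ℝ => f p.1 p.2) (Ici 0 ×ˢ Icc 0 L)) :
    Continuous fun t => ∫ x in (0 : ℝ)..L, f (max t 0) x := by
  have hc : Continuous (Function.uncurry fun t x : ℝ => f (max t 0) (max 0 (min x L))) := by
    refine hf.comp_continuous (f := fun p : ℝ × ℝ => (max p.1 0, max 0 (min p.2 L)))
      (by fun_prop) fun p => ⟨mem_Ici.2 (le_max_right _ _), le_max_left _ _, ?_⟩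
    exact max_le hL (min_le_right _ _)
  refine (intervalIntegral.continuous_parametric_intervalIntegral_of_continuous'
    (μ := volume) hc 0 L).congr fun t => ?_
  refine intervalIntegral.integral_congr fun x hx => ?_
  rw [uIcc_of_le hL] at hx
  simp [hx.1, hx.2]

/-- Differentiation under the integral sign over `[0, L]`, at positive times. -/
lemma hasDerivAt_integral_of_continuousOn {f f' : ℝ → ℝ → ℝ} {L : ℝ} (hL : 0 ≤ L)
    (hf : ContinuousOn (fun p : ℝ × ℝ => f p.1 p.2) (Ici 0 ×ˢ Icc 0 L))
    (hf' : ContinuousOn (fun p : ℝ × ℝ => f' p.1 p.2) (Ici 0 ×ˢ Icc 0 L))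
    (hder : ∀ t ∈ Ici (0 : ℝ), ∀ x ∈ Icc (0 : ℝ) L, HasDerivAt (fun s => f s x) (f' t x) t)
    {t : ℝ} (ht : 0 < t) :
    HasDerivAt (fun s => ∫ x in (0 : ℝ)..L, f s x) (∫ x in (0 : ℝ)..L, f' t x) t := by
  have hslice : ∀ {h : ℝ → ℝ → ℝ},
      ContinuousOn (fun p : ℝ × ℝ => h p.1 p.2) (Ici 0 ×ˢ Icc 0 L) →
      ∀ s, 0 ≤ s → IntervalIntegrable (h s) volume 0 L := by
    intro h hh s hs
    refine ContinuousOn.intervalIntegrable ?_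
    rw [uIcc_of_le hL]
    exact hh.comp (f := fun x : ℝ => (s, x)) (by fun_prop) fun x hx => ⟨hs, hx⟩
  obtain ⟨C, hC⟩ := (isCompact_Icc.prod isCompact_Icc).exists_bound_of_continuousOn
    (hf'.mono (prod_mono (fun s (hs : s ∈ Icc 0 (2 * t)) => hs.1) (subset_refl (Icc 0 L))))
  have hnhds : Ioo 0 (2 * t) ∈ nhds t := Ioo_mem_nhds ht (by linarith)
  have hsub : ∀ x ∈ uIoc 0 L, x ∈ Icc 0 L := fun x hx => by
    rw [uIoc_of_le hL] at hx
    exact Ioc_subset_Icc_self hx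
  refine (intervalIntegral.hasDerivAt_integral_of_dominated_loc_of_deriv_le
    (F := f) (F' := f') (bound := fun _ => C) hnhds ?_ (hslice hf t ht.le)
    (hslice hf' t ht.le).def'.aestronglyMeasurable ?_ intervalIntegrable_const ?_).2
  · filter_upwards [hnhds] with s hs using (hslice hf s hs.1.le).def'.aestronglyMeasurable
  · exact Filter.Eventually.of_forall fun x hx s hs =>
      hC (s, x) ⟨Ioo_subset_Icc_self hs, hsub x hx⟩
  · exact Filter.Eventually.of_forall fun x hx s hs => hder s hs.1.le x (hsub x hx)

/-- Lemma 1 of the paper for classical solutions: under the dissipativity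
assumption (2), the space-time `L²` norm (with weight `E`) of the state over the infinite
time horizon is bounded by a `T`-independent constant times the squared norms of the
boundary control and the initial state:
`∫_0^∞ ∫_0^L rᵀ E r dx dτ ≤ (2/(1 − exp ν_a)) (C̃₀ + K̃)(‖u‖² + ‖h₀‖²)`. -/
theorem stmt18
    (L : ℝ) (hL : 0 < L)
    (dp dm dp' dm' : ℝ → ℝ)
    (hdp : ∀ x ∈ Icc (0 : ℝ) L, HasDerivAt dp (dp' x) x)
    (hdm : ∀ x ∈ Icc (0 : ℝ) L, HasDerivAt dm (dm' x) x)
    (hdpc : ContinuousOn dp' (Icc (0 : ℝ) L)) (hdmc : ContinuousOn dm' (Icc (0 : ℝ) L))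
    (hsign : ∀ x ∈ Icc (0 : ℝ) L, dm x < 0 ∧ 0 < dp x)
    (M : ℝ → Matrix (Fin 2) (Fin 2) ℝ) (hM : ContinuousOn M (Icc (0 : ℝ) L))
    (η₀ : ℝ) (hη : η₀ ≤ 0)
    (μp μm : ℝ) (hμp : 0 < μp) (hμm : 0 < μm)
    (νa : ℝ) (hνa : νa < 0)
    (D : ℝ → Matrix (Fin 2) (Fin 2) ℝ) (hD : ∀ x, D x = Matrix.diagonal ![dp x, dm x])
    (D' : ℝ → Matrix (Fin 2) (Fin 2) ℝ) (hD' : ∀ x, D' x = Matrix.diagonal ![dp' x, dm' x])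
    (E : ℝ → Matrix (Fin 2) (Fin 2) ℝ)
    (hE : ∀ x, E x = Matrix.diagonal ![exp (-μp * x), exp (μm * x)])
    (E' : ℝ → Matrix (Fin 2) (Fin 2) ℝ)
    (hE' : ∀ x, E' x = Matrix.diagonal ![-μp * exp (-μp * x), μm * exp (μm * x)])
    (hmat : ∀ x ∈ Icc (0 : ℝ) L, ∀ v : Fin 2 → ℝ,
      v ⬝ᵥ (E' x * D x + E x * D' x - |η₀| • (E x * M x + (M x)ᵀ * E x)).mulVec v
        ≤ νa * (v ⬝ᵥ (E x).mulVec v))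
    (T : ℝ) (hT : 0 < T)
    (u : ℝ → Fin 2 → ℝ) (hu : ContinuousOn u (Ici (0 : ℝ)))
    (huT : ∀ t, T ≤ t → u t = 0)
    (h₀ : ℝ → Fin 2 → ℝ) (hh₀ : ContinuousOn h₀ (Icc (0 : ℝ) L))
    (r rt rx : ℝ → ℝ → Fin 2 → ℝ)
    (hrt : ∀ t ∈ Ici (0 : ℝ), ∀ x ∈ Icc (0 : ℝ) L,
      HasDerivAt (fun s => r s x) (rt t x) t)
    (hrx : ∀ t ∈ Ici (0 : ℝ), ∀ x ∈ Icc (0 : ℝ) L,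
      HasDerivAt (fun y => r t y) (rx t x) x)
    (hrc : ContinuousOn (fun p : ℝ × ℝ => r p.1 p.2) (Ici 0 ×ˢ Icc 0 L))
    (hrtc : ContinuousOn (fun p : ℝ × ℝ => rt p.1 p.2) (Ici 0 ×ˢ Icc 0 L))
    (hrxc : ContinuousOn (fun p : ℝ × ℝ => rx p.1 p.2) (Ici 0 ×ˢ Icc 0 L))
    (hinit : ∀ x ∈ Icc (0 : ℝ) L, r 0 x = h₀ x)
    (hpde : ∀ t ∈ Ici (0 : ℝ), ∀ x ∈ Icc (0 : ℝ) L,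
      rt t x + (D x).mulVec (rx t x) = η₀ • (M x).mulVec (r t x))
    (hbc0 : ∀ t ∈ Ici (0 : ℝ), r t 0 0 = u t 0)
    (hbcL : ∀ t ∈ Ici (0 : ℝ), r t L 1 = u t 1)
    (K : ℝ) (hK : K = max (|dm L| * exp (μm * L)) (dp 0))
    (Ea : ℝ → ℝ)
    (hEa : ∀ t, Ea t
      = (1 / 2) * ∫ τ in t..(t + 1), ∫ x in (0 : ℝ)..L, r τ x ⬝ᵥ (E x).mulVec (r τ x))
    (C₀ : ℝ) (hC₀ : 0 ≤ C₀)
    (hEa0 : Ea 0 ≤ C₀ * ((∫ τ in (0 : ℝ)..T, (u τ 0 ^ 2 + u τ 1 ^ 2))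
        + ∫ x in (0 : ℝ)..L, (h₀ x 0 ^ 2 + h₀ x 1 ^ 2))) :
    ∫ τ in Ioi (0 : ℝ), (∫ x in (0 : ℝ)..L, r τ x ⬝ᵥ (E x).mulVec (r τ x))
      ≤ (2 / (1 - exp νa)) * (C₀ + K) * ((∫ τ in (0 : ℝ)..T, (u τ 0 ^ 2 + u τ 1 ^ 2))
        + ∫ x in (0 : ℝ)..L, (h₀ x 0 ^ 2 + h₀ x 1 ^ 2)) := by
  have hL0 := hL.le
  have hdpcont : ContinuousOn dp (Icc 0 L) := fun x hx =>
    (hdp x hx).continuousAt.continuousWithinAt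
  have hdmcont : ContinuousOn dm (Icc 0 L) := fun x hx =>
    (hdm x hx).continuousAt.continuousWithinAt
  have hK0 : 0 ≤ K := by
    rw [hK]
    exact le_max_of_le_right (hsign 0 (left_mem_Icc.2 hL0)).2.le
  set f : ℝ → ℝ → ℝ := fun t x =>
    exp (-μp * x) * r t x 0 ^ 2 + exp (μm * x) * r t x 1 ^ 2 with hf
  set f' : ℝ → ℝ → ℝ := fun t x =>
    exp (-μp * x) * (2 * r t x 0 * rt t x 0) + exp (μm * x) * (2 * r t x 1 * rt t x 1) with hf'
  set g : ℝ → ℝ := fun t => u t 0 ^ 2 + u t 1 ^ 2 with hg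
  have hquad : ∀ t x, r t x ⬝ᵥ (E x).mulVec (r t x) = f t x := by
    intro t x
    simp only [hE, hf, dotProduct, Fin.sum_univ_two, mulVec_diagonal, cons_val_zero, cons_val_one]
    ring
  have hrc' := fun i => (continuousOn_pi.1 hrc) i
  have hrtc' := fun i => (continuousOn_pi.1 hrtc) i
  have hrxc' := fun i => (continuousOn_pi.1 hrxc) i
  have hslice : ∀ {h : ℝ → ℝ → ℝ},
      ContinuousOn (fun p : ℝ × ℝ => h p.1 p.2) (Ici 0 ×ˢ Icc 0 L) →
      ∀ s, 0 ≤ s → ContinuousOn (h s) (Icc 0 L) := fun hh s hs =>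
    hh.comp (f := fun x : ℝ => (s, x)) (by fun_prop) fun x hx => ⟨hs, hx⟩
  have hfc : ContinuousOn (fun p : ℝ × ℝ => f p.1 p.2) (Ici 0 ×ˢ Icc 0 L) := by
    have h0 := hrc' 0
    have h1 := hrc' 1
    simp only [hf]
    fun_prop
  have hfc' : ContinuousOn (fun p : ℝ × ℝ => f' p.1 p.2) (Ici 0 ×ˢ Icc 0 L) := by
    have h0 := hrc' 0
    have h1 := hrc' 1
    have h2 := hrtc' 0
    have h3 := hrtc' 1
    simp only [hf']
    fun_prop
  have hfder : ∀ t ∈ Ici (0 : ℝ), ∀ x ∈ Icc (0 : ℝ) L,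
      HasDerivAt (fun s => f s x) (f' t x) t := by
    intro t ht x hx
    have h := hasDerivAt_pi.1 (hrt t ht x hx)
    refine ((((h 0).pow 2).const_mul (exp (-μp * x))).add
      (((h 1).pow 2).const_mul (exp (μm * x)))).congr_deriv ?_
    simp [hf']
  have hbound : ∀ t, 0 ≤ t →
      ∫ x in (0 : ℝ)..L, f' t x ≤ νa * (∫ x in (0 : ℝ)..L, f t x) + K * g t := by
    intro t ht
    set F : ℝ → ℝ := fun x =>
      dp x * exp (-μp * x) * r t x 0 ^ 2 + dm x * exp (μm * x) * r t x 1 ^ 2 with hF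
    set F' : ℝ → ℝ := fun x =>
      (dp' x * exp (-μp * x) + dp x * (exp (-μp * x) * -μp)) * r t x 0 ^ 2
        + dp x * exp (-μp * x) * (2 * r t x 0 * rx t x 0)
        + ((dm' x * exp (μm * x) + dm x * (exp (μm * x) * μm)) * r t x 1 ^ 2
        + dm x * exp (μm * x) * (2 * r t x 1 * rx t x 1)) with hF'
    have hFd : ∀ x ∈ uIcc 0 L, HasDerivAt F (F' x) x := by
      intro x hx
      rw [uIcc_of_le hL0] at hx
      have h := hasDerivAt_pi.1 (hrx t ht x hx)
      have ep : HasDerivAt (fun y => exp (-μp * y)) (exp (-μp * x) * -μp) x := by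
        simpa using ((hasDerivAt_id x).const_mul (-μp)).exp
      have em : HasDerivAt (fun y => exp (μm * y)) (exp (μm * x) * μm) x := by
        simpa using ((hasDerivAt_id x).const_mul μm).exp
      refine ((((hdp x hx).mul ep).mul ((h 0).pow 2)).add
        (((hdm x hx).mul em).mul ((h 1).pow 2))).congr_deriv ?_
      simp [hF']
    have hFcont : ContinuousOn F' (Icc 0 L) := by
      have h0 := hslice (h := fun s y => r s y 0) (hrc' 0) t ht
      have h1 := hslice (h := fun s y => r s y 1) (hrc' 1) t ht
      have h2 := hslice (h := fun s y => rx s y 0) (hrxc' 0) t ht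
      have h3 := hslice (h := fun s y => rx s y 1) (hrxc' 1) t ht
      simp only [hF']
      fun_prop
    have hint : ∀ {h : ℝ → ℝ}, ContinuousOn h (Icc 0 L) → IntervalIntegrable h volume 0 L :=
      fun hh => ContinuousOn.intervalIntegrable (by rwa [uIcc_of_le hL0])
    have hFint := intervalIntegral.integral_eq_sub_of_hasDerivAt hFd (hint hFcont)
    have hpoint : ∀ x ∈ Icc 0 L, f' t x ≤ νa * f t x - F' x := by
      intro x hx
      have hm := hmat x hx (r t x)
      rw [hquad, abs_of_nonpos hη] at hm
      have hp := hpde t ht x hx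
      have hp0 := congrFun hp 0
      have hp1 := congrFun hp 1
      simp only [hE, hE', hD, hD', dotProduct, mulVec, Fin.sum_univ_two, Matrix.add_apply,
        Matrix.sub_apply, Matrix.smul_apply, Matrix.mul_apply, Matrix.transpose_apply,
        Matrix.diagonal_apply, Pi.add_apply, Pi.smul_apply, smul_eq_mul, cons_val_zero,
        cons_val_one, Fin.isValue, if_true, zero_ne_one, one_ne_zero, if_false, zero_mul, mul_zero,
        add_zero, zero_add] at hm hp0 hp1
      refine le_of_eq_of_le ?_ (sub_le_sub_right hm (F' x))
      simp only [hf', hF']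
      linear_combination (2 * exp (-μp * x) * r t x 0) * hp0 + (2 * exp (μm * x) * r t x 1) * hp1
    have hfi := hint (hslice hfc t ht)
    have hmono := intervalIntegral.integral_mono_on hL0 (hint (hslice hfc' t ht))
      ((hfi.const_mul νa).sub (hint hFcont)) hpoint
    rw [intervalIntegral.integral_sub (hfi.const_mul νa) (hint hFcont),
      intervalIntegral.integral_const_mul, hFint] at hmono
    have hs0 := hsign 0 (left_mem_Icc.2 hL0)
    have hsL := hsign L (right_mem_Icc.2 hL0)
    have hKL : -dm L * exp (μm * L) ≤ K := by
      rw [hK, ← abs_of_neg hsL.1]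
      exact le_max_left _ _
    have hKp : dp 0 ≤ K := by
      rw [hK]
      exact le_max_right _ _
    have hbdry : -(F L - F 0) ≤ K * g t := by
      simp only [hF, hg, mul_zero, exp_zero, mul_one, hbc0 t ht, hbcL t ht]
      have h1 := mul_nonneg (mul_nonneg hsL.2.le (exp_pos (-μp * L)).le) (sq_nonneg (r t L 0))
      have h2 := mul_nonneg (neg_nonneg.2 hs0.1.le) (sq_nonneg (r t 0 1))
      have h3 := mul_le_mul_of_nonneg_right hKL (sq_nonneg (u t 1))
      have h4 := mul_le_mul_of_nonneg_right hKp (sq_nonneg (u t 0))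
      linarith
    linarith
  have hucomp := fun i => (continuousOn_pi.1 hu) i
  have hgc : Continuous fun t => g (max t 0) := by
    have hgon : ContinuousOn g (Ici 0) := by
      have h0 := hucomp 0
      have h1 := hucomp 1
      simp only [hg]
      fun_prop
    exact hgon.comp_continuous (by fun_prop) fun t => mem_Ici.2 (le_max_right _ _)
  have hf0 : ∀ t x, 0 ≤ f t x := fun t x => by positivity
  have hg0 : ∀ t, 0 ≤ g t := fun t => by positivity
  have hmain := integral_Ioi_le_of_dissipation (T := T) (K := K) hνa hK0 hT.le
    (continuous_integral_max hL0 hfc)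
    (fun t => intervalIntegral.integral_nonneg hL0 fun x _ => hf0 _ x) hgc (fun t => hg0 _)
    (fun t ht => by
      simp only [hg, max_eq_left (hT.le.trans ht), huT t ht]
      simp)
    (V' := fun t => ∫ x in (0 : ℝ)..L, f' t x)
    (fun t ht => by
      refine (hasDerivAt_integral_of_continuousOn hL0 hfc hfc' hfder ht).congr_of_eventuallyEq ?_
      filter_upwards [lt_mem_nhds ht] with s hs
      simp only [max_eq_left hs.le])
    (fun t ht => by
      simp only [max_eq_left ht.le]
      exact hbound t ht.le)
  have e1 : ∫ t in Ioi (0 : ℝ), ∫ x in (0 : ℝ)..L, f (max t 0) x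
      = ∫ t in Ioi (0 : ℝ), ∫ x in (0 : ℝ)..L, f t x :=
    setIntegral_congr_fun measurableSet_Ioi fun t ht => by
      simp only [max_eq_left (le_of_lt (mem_Ioi.1 ht))]
  have e2 : ∫ t in (0 : ℝ)..1, ∫ x in (0 : ℝ)..L, f (max t 0) x
      = ∫ t in (0 : ℝ)..1, ∫ x in (0 : ℝ)..L, f t x :=
    intervalIntegral.integral_congr fun t ht => by
      rw [uIcc_of_le zero_le_one] at ht
      simp only [max_eq_left ht.1]
  have e3 : ∫ t in (0 : ℝ)..T, g (max t 0) = ∫ t in (0 : ℝ)..T, g t :=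
    intervalIntegral.integral_congr fun t ht => by
      rw [uIcc_of_le hT.le] at ht
      simp only [max_eq_left ht.1]
  rw [e1, e2, e3] at hmain
  rw [hEa, zero_add] at hEa0
  simp only [hquad] at hEa0 ⊢
  have hU0 : 0 ≤ ∫ t in (0 : ℝ)..T, g t := intervalIntegral.integral_nonneg hT.le fun t _ => hg0 t
  have hH0 : 0 ≤ ∫ x in (0 : ℝ)..L, (h₀ x 0 ^ 2 + h₀ x 1 ^ 2) :=
    intervalIntegral.integral_nonneg hL0 fun x _ => by positivity
  have hexp : 0 ≤ 1 / (1 - exp νa) := by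
    have := exp_lt_exp.2 hνa
    rw [exp_zero] at this
    exact one_div_nonneg.2 (by linarith)
  refine hmain.trans ?_
  rw [show ∀ a b c : ℝ, 2 / a * b * c = 1 / a * (2 * (b * c)) from fun a b c => by ring]
  refine mul_le_mul_of_nonneg_left ?_ hexp
  have hKU := mul_nonneg hK0 hU0
  have hKH := mul_nonneg hK0 hH0
  linarith
end
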